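/- arXiv:1511.06177 — 2 statements merged into one kernel-verified Lean document; each statement's English description precedes it below -/
import Mathlib

section
/- Let a and k be positive integers with a*k odd. For every positive integer m, t(a,3a,k,k;m) = (2/3)·N(a,3a,2k,2k; 8m+4a+2k). -/
/-- `N a b c d n` : number of integer quadruples `(x,y,z,w)` with
`n = a*x^2 + b*y^2 + c*z^2 + d*w^2`. -/
noncomputable def N (a b c d : ℕ) (n : ℕ) : ℕ :=
  Set.ncard {P : ℤ × ℤ × ℤ × ℤ |
    (n : ℤ) = a * P.1 ^ 2 + b * P.2.1 ^ 2 + c * P.2.2.1 ^ 2 + d * P.2.2.2 ^ 2}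

/-- `t a b c d n` : number of integer quadruples `(x,y,z,w)` with
`n = a*x(x-1)/2 + b*y(y-1)/2 + c*z(z-1)/2 + d*w(w-1)/2`. -/
noncomputable def t (a b c d : ℕ) (n : ℕ) : ℕ :=
  Set.ncard {P : ℤ × ℤ × ℤ × ℤ |
    (n : ℤ) = a * (P.1 * (P.1 - 1) / 2) + b * (P.2.1 * (P.2.1 - 1) / 2)
      + c * (P.2.2.1 * (P.2.2.1 - 1) / 2) + d * (P.2.2.2 * (P.2.2.2 - 1) / 2)}

lemma aux_A (x y : ℤ) : ((x^2+3*y^2) % 8 = 4 ∧ ((x % 2 = 1 ∧ y % 2 = 1) ∨ (x % 2 = 0 ∧ y % 2 = 0 ∧ (x + y) % 4 = 2)))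
    ∨ (x^2+3*y^2) % 8 = 0 ∨ (x^2+3*y^2) % 2 = 1 := by
  have hx : x % 8 = 0 ∨ x % 8 = 1 ∨ x % 8 = 2 ∨ x % 8 = 3 ∨ x % 8 = 4 ∨ x % 8 = 5 ∨ x % 8 = 6 ∨ x % 8 = 7 := by omega
  have hx2 : x^2 % 8 = (x % 8)^2 % 8 := by simp [pow_two, Int.mul_emod]
  have hy : y % 8 = 0 ∨ y % 8 = 1 ∨ y % 8 = 2 ∨ y % 8 = 3 ∨ y % 8 = 4 ∨ y % 8 = 5 ∨ y % 8 = 6 ∨ y % 8 = 7 := by omega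
  have hy2 : y^2 % 8 = (y % 8)^2 % 8 := by simp [pow_two, Int.mul_emod]
  generalize x^2 = X at *
  generalize y^2 = Y at *
  rcases hx with h | h | h | h | h | h | h | h <;> rw [h] at hx2 <;>
  rcases hy with h' | h' | h' | h' | h' | h' | h' | h' <;> rw [h'] at hy2 <;> norm_num at hx2 hy2 <;> omega

lemma aux_B (u v : ℤ) : (u^2+v^2) % 4 ≠ 3 ∧ ((u^2+v^2) % 2 = (u+v) % 2) := by
  have hx : u % 4 = 0 ∨ u % 4 = 1 ∨ u % 4 = 2 ∨ u % 4 = 3 := by omega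
  have hx2 : u^2 % 4 = (u % 4)^2 % 4 := by simp [pow_two, Int.mul_emod]
  have hy : v % 4 = 0 ∨ v % 4 = 1 ∨ v % 4 = 2 ∨ v % 4 = 3 := by omega
  have hy2 : v^2 % 4 = (v % 4)^2 % 4 := by simp [pow_two, Int.mul_emod]
  generalize u^2 = X at *
  generalize v^2 = Y at *
  rcases hx with h | h | h | h <;> rw [h] at hx2 <;>
  rcases hy with h' | h' | h' | h' <;> rw [h'] at hy2 <;> norm_num at hx2 hy2 <;> omega

lemma aux_par (a k m x y u v : ℤ) (ha : a % 2 = 1) (hk : k % 2 = 1)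
    (h : 8*m+4*a+2*k = a*x^2+3*a*y^2+2*k*u^2+2*k*v^2) :
    (u + v) % 2 = 1 ∧ ((x % 2 = 1 ∧ y % 2 = 1) ∨ (x % 2 = 0 ∧ y % 2 = 0 ∧ (x + y) % 4 = 2)) := by
  have hA := aux_A x y
  have hB := aux_B u v
  have h1 : 8*m+4*a+2*k = a*(x^2+3*y^2)+2*(k*(u^2+v^2)) := by rw [h]; ring
  generalize x^2+3*y^2 = A at *
  generalize u^2+v^2 = B at *
  obtain ⟨c, rfl⟩ : ∃ c, a = 2*c+1 := ⟨a/2, by omega⟩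
  obtain ⟨d, rfl⟩ : ∃ c, k = 2*c+1 := ⟨k/2, by omega⟩
  rcases hA with ⟨h4, hA⟩ | hA | hA
  · refine ⟨?_, hA⟩
    obtain ⟨e, rfl⟩ : ∃ e, A = 8*e+4 := ⟨A/8, by omega⟩
    ring_nf at h1
    rcases Int.even_or_odd' B with ⟨f, rfl | rfl⟩
    · ring_nf at h1; omega
    · omega
  · exfalso
    obtain ⟨e, rfl⟩ : ∃ e, A = 8*e := ⟨A/8, by omega⟩
    obtain ⟨f, hf⟩ : ∃ f, B = 4*f ∨ B = 4*f+1 ∨ B = 4*f+2 := ⟨B/4, by omega⟩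
    rcases hf with rfl | rfl | rfl <;> ring_nf at h1 <;> omega
  · exfalso
    obtain ⟨e, rfl⟩ : ∃ e, A = 2*e+1 := ⟨A/2, by omega⟩
    ring_nf at h1
    omega

lemma aux_tri (x : ℤ) : 8 * (x*(x-1)/2) = (2*x-1)^2 - 1 := by
  have h : 2 ∣ x*(x-1) := by
    rcases Int.even_or_odd' x with ⟨f, rfl | rfl⟩
    · exact ⟨f*(2*f-1), by ring⟩
    · exact ⟨(2*f+1)*f, by ring⟩
  have := Int.mul_ediv_cancel' h
  linear_combination 4 * this

lemma aux_bd (a x n : ℤ) (ha : 0 < a) (h : a * x^2 ≤ n) : x ∈ Set.Icc (-n) n := by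
  have h1 : x^2 ≤ n := by nlinarith [sq_nonneg x]
  constructor <;> nlinarith [sq_nonneg x, Int.le_self_sq x, Int.le_self_sq (-x)]

theorem stmt6 (a k : ℕ) (ha : 0 < a) (hk : 0 < k) (hodd : Odd (a * k))
    (m : ℕ) (hm : 0 < m) :
    (t a (3 * a) k k m : ℚ) = 2 / 3 * (N a (3 * a) (2 * k) (2 * k) (8 * m + 4 * a + 2 * k) : ℚ) := by
  obtain ⟨hao, hko⟩ := Nat.odd_mul.mp hodd
  have hao' : (a : ℤ) % 2 = 1 := by have := Nat.odd_iff.mp hao; omega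
  have hko' : (k : ℤ) % 2 = 1 := by have := Nat.odd_iff.mp hko; omega
  have ha' : (0 : ℤ) < a := by exact_mod_cast ha
  have hk' : (0 : ℤ) < k := by exact_mod_cast hk
  unfold t N
  push_cast
  set S : Set (ℤ × ℤ × ℤ × ℤ) := {P | (8 * (m:ℤ) + 4 * a + 2 * k) = a * P.1 ^ 2 + 3 * a * P.2.1 ^ 2 + 2 * k * P.2.2.1 ^ 2 + 2 * k * P.2.2.2 ^ 2} with hS
  have par : ∀ P ∈ S, _ := fun P hP => aux_par a k m P.1 P.2.1 P.2.2.1 P.2.2.2 hao' hko' hP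
  have hfin : S.Finite := by
    set n : ℤ := 8 * (m:ℤ) + 4 * a + 2 * k with hn
    refine Set.Finite.subset ((Set.finite_Icc (-n) n).prod ((Set.finite_Icc (-n) n).prod
      ((Set.finite_Icc (-n) n).prod (Set.finite_Icc (-n) n)))) ?_
    rintro ⟨x, y, u, v⟩ h
    simp only [hS, Set.mem_setOf_eq] at h
    have h1 : 0 ≤ a * x^2 := by positivity
    have h2 : 0 ≤ 3 * a * y^2 := by positivity
    have h3 : 0 ≤ 2 * k * u^2 := by positivity
    have h4 : 0 ≤ 2 * k * v^2 := by positivity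
    have p1 : (0:ℤ) ≤ a * x^2 := by positivity
    have p2 : (0:ℤ) ≤ 3 * a * y^2 := by positivity
    have p3 : (0:ℤ) ≤ 2 * k * u^2 := by positivity
    have p4 : (0:ℤ) ≤ 2 * k * v^2 := by positivity
    exact ⟨aux_bd a x n ha' (by linarith), aux_bd (3*a) y n (by linarith) (by linarith),
      aux_bd (2*k) u n (by linarith) (by linarith), aux_bd (2*k) v n (by linarith) (by linarith)⟩
  set E := {P ∈ S | P.1 % 2 = 0} with hE
  set O1 := {P ∈ S | P.1 % 2 = 1 ∧ (P.1 - P.2.1) % 4 = 0} with hO1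
  set O2 := {P ∈ S | P.1 % 2 = 1 ∧ (P.1 + P.2.1) % 4 = 0} with hO2
  set O := {P ∈ S | P.1 % 2 = 1} with hO
  have hOu : O = O1 ∪ O2 := by
    ext P
    simp only [hO, hO1, hO2, Set.mem_union, Set.mem_setOf_eq]
    constructor
    · rintro ⟨h, h1⟩
      have := par P h
      have : (P.1 - P.2.1) % 4 = 0 ∨ (P.1 + P.2.1) % 4 = 0 := by omega
      tauto
    · tauto
  have hSu : S = E ∪ O := by
    ext P
    simp only [hE, hO, Set.mem_union, Set.mem_setOf_eq]
    have : P.1 % 2 = 0 ∨ P.1 % 2 = 1 := by omega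
    tauto
  have fE : E.Finite := hfin.subset fun P h => h.1
  have fO : O.Finite := hfin.subset fun P h => h.1
  have fO1 : O1.Finite := hfin.subset fun P h => h.1
  have fO2 : O2.Finite := hfin.subset fun P h => h.1
  have c1 : S.ncard = E.ncard + O.ncard := by
    rw [hSu]
    refine Set.ncard_union_eq ?_ fE fO
    rw [Set.disjoint_left]
    rintro P ⟨_, h⟩ ⟨_, h'⟩
    omega
  have c2 : O.ncard = O1.ncard + O2.ncard := by
    rw [hOu]
    refine Set.ncard_union_eq ?_ fO1 fO2
    rw [Set.disjoint_left]
    rintro P ⟨_, h⟩ ⟨_, h'⟩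
    omega
  have c3 : O1.ncard = O2.ncard := by
    refine Set.ncard_congr (fun P _ => (P.1, -P.2.1, P.2.2)) ?_ ?_ ?_
    · rintro ⟨x, y, u, v⟩ ⟨h, h1, h2⟩
      simp only [hS, Set.mem_setOf_eq] at h h1 h2
      refine ⟨?_, ?_, ?_⟩
      · simp only [hS, Set.mem_setOf_eq]; rw [h]; ring
      · simpa using h1
      · simp only; omega
    · rintro ⟨x, y, u, v⟩ ⟨x', y', u', v'⟩ _ _ h
      simpa using h
    · rintro ⟨x, y, u, v⟩ ⟨h, h1, h2⟩
      simp only [hS, Set.mem_setOf_eq] at h h1 h2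
      refine ⟨(x, -y, u, v), ⟨?_, ?_, ?_⟩, by simp⟩
      · simp only [hS, Set.mem_setOf_eq]; rw [h]; ring
      · simpa using h1
      · simp only; omega
  have c4 : E.ncard = O1.ncard := by
    refine Set.ncard_congr (fun P _ => (P.1/2 + 3*(P.2.1/2), P.1/2 - P.2.1/2, P.2.2)) ?_ ?_ ?_
    · rintro ⟨x, y, u, v⟩ ⟨h, h1⟩
      have hp := par _ h
      simp only [hS, Set.mem_setOf_eq] at h h1 hp
      obtain ⟨p, rfl⟩ : ∃ p, x = 2*p := ⟨x/2, by omega⟩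
      obtain ⟨q, rfl⟩ : ∃ p, y = 2*p := ⟨y/2, by omega⟩
      have e1 : 2*p/2 = p := by omega
      have e2 : 2*q/2 = q := by omega
      refine ⟨?_, ?_, ?_⟩
      · simp only [hS, Set.mem_setOf_eq, e1, e2]; rw [h]; ring
      · simp only; omega
      · simp only; omega
    · rintro ⟨x, y, u, v⟩ ⟨x', y', u', v'⟩ ⟨h, h1⟩ ⟨h', h1'⟩ hh
      have hp := par _ h
      have hp' := par _ h'
      simp only [Prod.mk.injEq] at hh hp hp' h1 h1' ⊢
      refine ⟨?_, ?_, hh.2.2⟩ <;> omega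
    · rintro ⟨x, y, u, v⟩ ⟨h, h1, h2⟩
      have hp := par _ h
      simp only [hS, Set.mem_setOf_eq] at h h1 h2 hp
      obtain ⟨q, rfl⟩ : ∃ q, x = y + 4 * q := ⟨(x-y)/4, by omega⟩
      refine ⟨(2*(y+q), 2*q, u, v), ⟨?_, ?_⟩, ?_⟩
      · simp only [hS, Set.mem_setOf_eq]; rw [h]; ring
      · simp only; omega
      · simp only [Prod.mk.injEq, and_true]; omega
  have c5 : Set.ncard {P : ℤ × ℤ × ℤ × ℤ |
    (m : ℤ) = a * (P.1 * (P.1 - 1) / 2) + 3 * a * (P.2.1 * (P.2.1 - 1) / 2)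
      + k * (P.2.2.1 * (P.2.2.1 - 1) / 2) + k * (P.2.2.2 * (P.2.2.2 - 1) / 2)} = O.ncard := by
    refine Set.ncard_congr (fun P _ => (2*P.1-1, 2*P.2.1-1, P.2.2.1+P.2.2.2-1, P.2.2.1-P.2.2.2)) ?_ ?_ ?_
    · rintro ⟨x, y, z, w⟩ h
      simp only [Set.mem_setOf_eq] at h
      refine ⟨?_, ?_⟩
      · simp only [hS, Set.mem_setOf_eq]
        linear_combination 8 * h + a * aux_tri x + 3 * a * aux_tri y + k * aux_tri z + k * aux_tri w
      · simp only; omega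
    · rintro ⟨x, y, u, v⟩ ⟨x', y', u', v'⟩ h h' hh
      simp only [Prod.mk.injEq] at hh ⊢
      omega
    · rintro ⟨x, y, u, v⟩ ⟨h, h1⟩
      have hp := par _ h
      simp only [hS, Set.mem_setOf_eq] at h h1 hp
      obtain ⟨p, rfl⟩ : ∃ p, x = 2*p-1 := ⟨(x+1)/2, by omega⟩
      obtain ⟨q, rfl⟩ : ∃ p, y = 2*p-1 := ⟨(y+1)/2, by omega⟩
      obtain ⟨w, rfl⟩ : ∃ w, u = v + 2*w - 1 := ⟨(u-v+1)/2, by omega⟩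
      refine ⟨(p, q, v+w, w), ?_, ?_⟩
      · simp only [Set.mem_setOf_eq]
        have : (8:ℤ) * m = 8 * (a * (p * (p - 1) / 2) + 3 * a * (q * (q - 1) / 2)
          + k * ((v+w) * ((v+w) - 1) / 2) + k * (w * (w - 1) / 2)) := by
          linear_combination h - a * aux_tri p - 3 * a * aux_tri q - k * aux_tri (v+w) - k * aux_tri w
        linarith
      · simp only [Prod.mk.injEq]; refine ⟨trivial, trivial, ?_, ?_⟩ <;> ring
  rw [c5, c1, c2, ← c3, c4]
  push_cast
  ring
end

section
/- Let a and k be positive integers with a odd. For every positive integer n, t(a,a,8a,2k; 2n) = t(a,2a,2a,k; n) and t(a,a,8a,2k; 2n+a) = 2·t(a,4a,4a,k; n). -/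
theorem T_two (x : ℤ) : 2 * (x * (x - 1) / 2) = x * (x - 1) := by
  have h : Even (x * (x - 1)) := Int.even_mul_pred_self x
  exact Int.mul_ediv_cancel' h.two_dvd

theorem T_par (x : ℤ) : (x * (x - 1) / 2) % 2 = 0 ↔ (x % 4 = 0 ∨ x % 4 = 1) := by
  have h := T_two x
  generalize x * (x - 1) / 2 = s at *
  obtain ⟨q, hx⟩ : ∃ q : ℤ, x = 4 * q ∨ x = 4 * q + 1 ∨ x = 4 * q + 2 ∨ x = 4 * q + 3 :=
    ⟨x / 4, by omega⟩
  rcases hx with rfl | rfl | rfl | rfl <;> ring_nf at h <;> omega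

def g1 (P : ℤ × ℤ × ℤ × ℤ) : ℤ × ℤ × ℤ × ℤ :=
  if (P.2.1 - P.2.2.1) % 2 = 0 then
    (P.1 + P.2.1 - P.2.2.1, P.2.1 - P.2.2.1 - P.1 + 1, (P.2.1 + P.2.2.1) / 2, P.2.2.2)
  else
    (P.1 + P.2.1 + P.2.2.1 - 1, P.1 - P.2.1 - P.2.2.1 + 1, (P.2.1 - P.2.2.1 + 1) / 2, P.2.2.2)

def g2 (Q : (ℤ × ℤ × ℤ × ℤ) × Bool) : ℤ × ℤ × ℤ × ℤ :=
  if Q.2 then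
    (Q.1.1 + 2 * Q.1.2.1 - 1, Q.1.1 - 2 * Q.1.2.1 + 1, Q.1.2.2.1, Q.1.2.2.2)
  else
    (Q.1.1 + 2 * Q.1.2.1 - 1, 2 * Q.1.2.1 - Q.1.1, Q.1.2.2.1, Q.1.2.2.2)

theorem odd_par (a : ℕ) (h : Odd a) (s r : ℤ) (e : (a : ℤ) * s = 2 * r) : s % 2 = 0 := by
  have h1 : Odd (a : ℤ) := by exact_mod_cast h
  have h2 : Even ((a : ℤ) * s) := ⟨r, by rw [e]; ring⟩
  rcases Int.even_mul.1 h2 with h3 | h3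
  · exact absurd h3 (Int.not_even_iff_odd.2 h1)
  · exact Int.even_iff.1 h3

theorem g1_id (x y z w : ℤ) :
    ∀ x' y' z' w', g1 (x, y, z, w) = (x', y', z', w') → w' = w ∧
    x' * (x' - 1) / 2 + y' * (y' - 1) / 2 + 8 * (z' * (z' - 1) / 2)
      = 2 * (x * (x - 1) / 2 + 2 * (y * (y - 1) / 2) + 2 * (z * (z - 1) / 2)) := by
  intro x' y' z' w' h
  have hx := T_two x
  have hy := T_two y
  have hz := T_two z
  have hx' := T_two x'
  have hy' := T_two y'
  have hz' := T_two z'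
  generalize x * (x - 1) / 2 = X at *
  generalize y * (y - 1) / 2 = Y at *
  generalize z * (z - 1) / 2 = Z at *
  generalize x' * (x' - 1) / 2 = X' at *
  generalize y' * (y' - 1) / 2 = Y' at *
  generalize z' * (z' - 1) / 2 = Z' at *
  unfold g1 at h
  split_ifs at h with hc <;> simp only [Prod.mk.injEq] at h hc <;> obtain ⟨h1, h2, h3, h4⟩ := h
  · refine ⟨h4.symm, ?_⟩
    obtain rfl : y = 2 * z' - z := by omega
    subst h1 h2
    apply mul_left_cancel₀ (two_ne_zero (α := ℤ))
    linear_combination hx' + hy' + 8 * hz' - 2 * hx - 4 * hy - 4 * hz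
  · refine ⟨h4.symm, ?_⟩
    obtain rfl : y = 2 * z' - 1 + z := by omega
    subst h1 h2
    apply mul_left_cancel₀ (two_ne_zero (α := ℤ))
    linear_combination hx' + hy' + 8 * hz' - 2 * hx - 4 * hy - 4 * hz

theorem g2_id (x y z w : ℤ) (b : Bool) :
    ∀ x' y' z' w', g2 ((x, y, z, w), b) = (x', y', z', w') → w' = w ∧
    x' * (x' - 1) / 2 + y' * (y' - 1) / 2 + 8 * (z' * (z' - 1) / 2)
      = 2 * (x * (x - 1) / 2 + 4 * (y * (y - 1) / 2) + 4 * (z * (z - 1) / 2)) + 1 := by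
  intro x' y' z' w' h
  have hx := T_two x
  have hy := T_two y
  have hz := T_two z
  have hx' := T_two x'
  have hy' := T_two y'
  have hz' := T_two z'
  generalize x * (x - 1) / 2 = X at *
  generalize y * (y - 1) / 2 = Y at *
  generalize z * (z - 1) / 2 = Z at *
  generalize x' * (x' - 1) / 2 = X' at *
  generalize y' * (y' - 1) / 2 = Y' at *
  generalize z' * (z' - 1) / 2 = Z' at *
  unfold g2 at h
  split_ifs at h with hc <;> simp only [Prod.mk.injEq] at h hc <;> obtain ⟨h1, h2, h3, h4⟩ := h
  all_goals
    refine ⟨h4.symm, ?_⟩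
    subst h1 h2 h3
    apply mul_left_cancel₀ (two_ne_zero (α := ℤ))
    linear_combination hx' + hy' + 8 * hz' - 2 * hx - 8 * hy - 8 * hz

theorem g1_inj (P Q : ℤ × ℤ × ℤ × ℤ) (h : g1 P = g1 Q) : P = Q := by
  obtain ⟨x, y, z, w⟩ := P
  obtain ⟨x', y', z', w'⟩ := Q
  unfold g1 at h
  split_ifs at h <;> simp only [Prod.mk.injEq] at * <;> omega

theorem g2_inj (P Q : (ℤ × ℤ × ℤ × ℤ) × Bool) (h : g2 P = g2 Q) : P = Q := by
  obtain ⟨⟨x, y, z, w⟩, b⟩ := P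
  obtain ⟨⟨x', y', z', w'⟩, b'⟩ := Q
  unfold g2 at h
  cases b <;> cases b' <;> simp at h ⊢ <;> omega

theorem g1_surj (x y z w : ℤ)
    (h : (x * (x - 1) / 2 + y * (y - 1) / 2) % 2 = 0) : ∃ P, g1 P = (x, y, z, w) := by
  have hx := T_par x
  have hy := T_par y
  generalize x * (x - 1) / 2 = X at *
  generalize y * (y - 1) / 2 = Y at *
  have hm : X % 2 = Y % 2 := by omega
  have hxy : (x % 4 = 0 ∨ x % 4 = 1) ↔ (y % 4 = 0 ∨ y % 4 = 1) := by rw [← hx, ← hy, hm]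
  clear hx hy hm h
  have hx4 : x % 4 = 0 ∨ x % 4 = 1 ∨ x % 4 = 2 ∨ x % 4 = 3 := by omega
  have hy4 : y % 4 = 0 ∨ y % 4 = 1 ∨ y % 4 = 2 ∨ y % 4 = 3 := by omega
  by_cases hp : (x + y) % 2 = 0
  · refine ⟨((x + y) / 2, (x - y) / 4 + z, (x - y) / 4 - z + 1, w), ?_⟩
    unfold g1
    rw [if_neg (by simp only; omega)]
    simp only [Prod.mk.injEq]
    rcases hx4 with h1 | h1 | h1 | h1 <;> rcases hy4 with h2 | h2 | h2 | h2 <;>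
      simp [h1, h2] at hxy <;> and_intros <;> first | trivial | omega
  · refine ⟨((x - y + 1) / 2, z + (x + y - 1) / 4, z - (x + y - 1) / 4, w), ?_⟩
    unfold g1
    rw [if_pos (by simp only; omega)]
    simp only [Prod.mk.injEq]
    rcases hx4 with h1 | h1 | h1 | h1 <;> rcases hy4 with h2 | h2 | h2 | h2 <;>
      simp [h1, h2] at hxy <;> and_intros <;> first | trivial | omega

theorem g2_surj (x y z w : ℤ)
    (h : (x * (x - 1) / 2 + y * (y - 1) / 2) % 2 = 1) : ∃ P, g2 P = (x, y, z, w) := by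
  have hx := T_par x
  have hy := T_par y
  generalize x * (x - 1) / 2 = X at *
  generalize y * (y - 1) / 2 = Y at *
  have hm : X % 2 = 0 ↔ ¬ Y % 2 = 0 := by omega
  have hxy : (x % 4 = 0 ∨ x % 4 = 1) ↔ ¬ (y % 4 = 0 ∨ y % 4 = 1) := by rw [← hx, ← hy, hm]
  clear hx hy hm h
  have hx4 : x % 4 = 0 ∨ x % 4 = 1 ∨ x % 4 = 2 ∨ x % 4 = 3 := by omega
  have hy4 : y % 4 = 0 ∨ y % 4 = 1 ∨ y % 4 = 2 ∨ y % 4 = 3 := by omega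
  by_cases hp : (x + y) % 2 = 0
  · refine ⟨(((x + y) / 2, (x - y + 2) / 4, z, w), true), ?_⟩
    simp only [g2, if_true, Prod.mk.injEq]
    rcases hx4 with h1 | h1 | h1 | h1 <;> rcases hy4 with h2 | h2 | h2 | h2 <;>
      simp [h1, h2] at hxy <;> and_intros <;> first | trivial | omega
  · refine ⟨(((x - y + 1) / 2, (x + y + 1) / 4, z, w), false), ?_⟩
    simp [g2]
    rcases hx4 with h1 | h1 | h1 | h1 <;> rcases hy4 with h2 | h2 | h2 | h2 <;>
      simp [h1, h2] at hxy <;> and_intros <;> first | trivial | omega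

theorem stmt11 (a k : ℕ) (ha : 0 < a) (hk : 0 < k) (haodd : Odd a)
    (n : ℕ) (hn : 0 < n) :
    t a a (8 * a) (2 * k) (2 * n) = t a (2 * a) (2 * a) k n ∧
    t a a (8 * a) (2 * k) (2 * n + a) = 2 * t a (4 * a) (4 * a) k n := by
  constructor
  · symm
    unfold t
    refine Set.ncard_congr (fun P _ => g1 P) ?_ (fun P Q _ _ h => g1_inj P Q h) ?_
    · rintro ⟨x, y, z, w⟩ hP
      obtain ⟨⟨x', y', z', w'⟩, hQ⟩ : ∃ Q, g1 (x, y, z, w) = Q := ⟨_, rfl⟩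
      obtain ⟨rfl, e⟩ := g1_id _ _ _ _ _ _ _ _ hQ
      rw [hQ]
      simp only [Set.mem_ofPred_eq] at hP ⊢
      push_cast at hP ⊢
      linear_combination 2 * hP - (a : ℤ) * e
    · rintro ⟨x, y, z, w⟩ hP
      simp only [Set.mem_ofPred_eq] at hP
      push_cast at hP
      obtain ⟨⟨x', y', z', w'⟩, hQ⟩ := g1_surj x y z w
        (odd_par a haodd _ (n - 4 * a * (z * (z - 1) / 2) - k * (w * (w - 1) / 2))
          (by linear_combination -hP))
      refine ⟨_, ?_, hQ⟩
      obtain ⟨rfl, e⟩ := g1_id _ _ _ _ _ _ _ _ hQ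
      simp only [Set.mem_ofPred_eq]
      push_cast
      apply mul_left_cancel₀ (two_ne_zero (α := ℤ))
      linear_combination hP + (a : ℤ) * e
  · symm
    have hb (S : Set (ℤ × ℤ × ℤ × ℤ)) : 2 * S.ncard = (S ×ˢ (Set.univ : Set Bool)).ncard := by
      rw [Set.ncard_prod, mul_comm]
      simp
    unfold t
    rw [hb]
    refine Set.ncard_congr (fun P _ => g2 P) ?_ (fun P Q _ _ h => g2_inj P Q h) ?_
    · rintro ⟨⟨x, y, z, w⟩, b⟩ hP
      obtain ⟨⟨x', y', z', w'⟩, hQ⟩ : ∃ Q, g2 ((x, y, z, w), b) = Q := ⟨_, rfl⟩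
      obtain ⟨rfl, e⟩ := g2_id _ _ _ _ _ _ _ _ _ hQ
      rw [hQ]
      simp only [Set.mem_prod, Set.mem_univ, and_true, Set.mem_ofPred_eq] at hP ⊢
      push_cast at hP ⊢
      linear_combination 2 * hP - (a : ℤ) * e
    · rintro ⟨x, y, z, w⟩ hP
      simp only [Set.mem_ofPred_eq] at hP
      push_cast at hP
      have hp := odd_par a haodd (x * (x - 1) / 2 + y * (y - 1) / 2 - 1)
          (n - 4 * a * (z * (z - 1) / 2) - k * (w * (w - 1) / 2))
          (by linear_combination -hP)
      obtain ⟨⟨⟨x', y', z', w'⟩, b⟩, hQ⟩ := g2_surj x y z w (by omega)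
      refine ⟨_, ?_, hQ⟩
      obtain ⟨rfl, e⟩ := g2_id _ _ _ _ _ _ _ _ _ hQ
      simp only [Set.mem_prod, Set.mem_univ, and_true, Set.mem_ofPred_eq]
      push_cast
      apply mul_left_cancel₀ (two_ne_zero (α := ℤ))
      linear_combination hP + (a : ℤ) * e
end
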